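/- Let X be a separable real Banach space, A ⊆ ℝⁿ Lebesgue measurable, f : A → X Lipschitz and ζ ∈ ℝⁿ \ {0}. Then the set of points x ∈ A such that both (i) A is dense at x in direction ζ and (ii) f is differentiable at x in direction ζ, is Lebesgue measurable. -/

import Mathlib

open MeasureTheory Filter Metric Set Topology

noncomputable section

/-- ℝⁿ as a Euclidean space. -/
abbrev Euc (n : ℕ) := EuclideanSpace ℝ (Fin n)

/-- `x` is a density point of `A`. -/
def DensityPoint {n : ℕ} (A : Set (Euc n)) (x : Euc n) : Prop :=
  Tendsto (fun r : ℝ => volume (A ∩ ball x r) / volume (ball x r)) (𝓝[>] (0:ℝ)) (𝓝 1)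

/-- The family `c t` approximates in `A` the direction `ζ` at the point `x`. -/
def ApproxInDir {n : ℕ} (A : Set (Euc n)) (x ζ : Euc n) (c : ℝ → Euc n) : Prop :=
  (∀ t > (0:ℝ), x + c t ∈ A) ∧
    Tendsto (fun t : ℝ => ‖c t - t • ζ‖ / t) (𝓝[>] (0:ℝ)) (𝓝 0)

/-- `f` is differentiable at `x ∈ A` in direction `ζ` with directional derivative `w`:
for every family approximating in `A` the direction `ζ` at `x`, the difference
quotients converge to `w`. -/
def HasDirDeriv {n : ℕ} {X : Type*} [NormedAddCommGroup X] [NormedSpace ℝ X]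
    (A : Set (Euc n)) (f : Euc n → X) (x ζ : Euc n) (w : X) : Prop :=
  ∀ c : ℝ → Euc n, ApproxInDir A x ζ c →
    Tendsto (fun t : ℝ => t⁻¹ • (f (x + c t) - f x)) (𝓝[>] (0:ℝ)) (𝓝 w)

/-- `A` is dense at `x` in direction `ζ`. -/
def DenseAtDir {n : ℕ} (A : Set (Euc n)) (x ζ : Euc n) : Prop :=
  Tendsto (fun t : ℝ =>
      volume {θ : ℝ | θ ∈ Ioo 0 t ∧ x + θ • ζ ∉ A} / ENNReal.ofReal t)
    (𝓝[>] (0:ℝ)) (𝓝 0)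

/-- A set `E` in a metric space is porous. -/
def IsPorous {M : Type*} [MetricSpace M] (E : Set M) : Prop :=
  ∃ Λ > (0:ℝ), ∀ a ∈ E, ∃ x : ℕ → M, Tendsto x atTop (𝓝 a) ∧
    ∀ k : ℕ, x k ≠ a ∧ ball (x k) (Λ * dist a (x k)) ∩ E = ∅

/-- A set is σ-porous if it is a countable union of porous sets. -/
def IsSigmaPorous {M : Type*} [MetricSpace M] (S : Set M) : Prop :=
  ∃ F : ℕ → Set M, S = ⋃ k, F k ∧ ∀ k, IsPorous (F k)

/-- The difference quotients of `f` at `x`, taken along points of `A` that lie `δ`-close to the ray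
from `x` in direction `ζ` at scales below `δ`, differ from each other by at most `ε`. -/
def QuotientsOscLE {n : ℕ} {X : Type*} [NormedAddCommGroup X] [NormedSpace ℝ X]
    (A : Set (Euc n)) (f : Euc n → X) (ζ : Euc n) (ε δ : ℝ) (x : Euc n) : Prop :=
  ∀ a ∈ A, ∀ b ∈ A, ∀ s ∈ Ioo 0 δ, ∀ t ∈ Ioo 0 δ,
    ‖a - x - s • ζ‖ < s * δ → ‖b - x - t • ζ‖ < t * δ →
      ‖s⁻¹ • (f a - f x) - t⁻¹ • (f b - f x)‖ ≤ ε

theorem isClosed_quotientsOscLE {n : ℕ} {X : Type*} [NormedAddCommGroup X] [NormedSpace ℝ X]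
    {A : Set (Euc n)} {f : Euc n → X} (hf : ContinuousOn f A) (ζ : Euc n) (ε δ : ℝ) :
    IsClosed {x : A | QuotientsOscLE A f ζ ε δ x} := by
  have hfc : Continuous fun x : A => f x := continuousOn_iff_continuous_domRestrict.1 hf
  have key : ∀ (a b : Euc n) (s t : ℝ), IsClosed {x : A |
      ‖a - x - s • ζ‖ < s * δ → ‖b - x - t • ζ‖ < t * δ →
        ‖s⁻¹ • (f a - f x) - t⁻¹ • (f b - f x)‖ ≤ ε} := fun a b s t =>
    isClosed_imp (isOpen_lt (by fun_prop) (by fun_prop))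
      (isClosed_imp (isOpen_lt (by fun_prop) (by fun_prop))
        (isClosed_le (((continuous_const.sub hfc).const_smul _).sub
          ((continuous_const.sub hfc).const_smul _)).norm continuous_const))
  simp only [QuotientsOscLE, ofPred_forall]
  exact isClosed_iInter fun a => isClosed_iInter fun _ => isClosed_iInter fun b =>
    isClosed_iInter fun _ => isClosed_iInter fun s => isClosed_iInter fun _ =>
    isClosed_iInter fun t => isClosed_iInter fun _ => by
      simpa only [ofPred_forall] using key a b s t

theorem nullMeasurableSet_quotientsOscLE {n : ℕ} {X : Type*} [NormedAddCommGroup X]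
    [NormedSpace ℝ X] {A : Set (Euc n)} (hA : NullMeasurableSet A volume) {f : Euc n → X}
    (hf : ContinuousOn f A) (ζ : Euc n) :
    NullMeasurableSet {x | x ∈ A ∧ ∀ m : ℕ, ∃ k : ℕ,
      QuotientsOscLE A f ζ (1 / ((m : ℝ) + 1)) (1 / ((k : ℝ) + 1)) x} volume := by
  have hmeas : MeasurableSet {x : A | ∀ m : ℕ, ∃ k : ℕ,
      QuotientsOscLE A f ζ (1 / ((m : ℝ) + 1)) (1 / ((k : ℝ) + 1)) x} := by
    simp only [ofPred_forall, ofPred_exists]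
    exact MeasurableSet.iInter fun m => MeasurableSet.iUnion fun k =>
      (isClosed_quotientsOscLE hf ζ _ _).measurableSet
  obtain ⟨B, hB, hBeq⟩ := hmeas
  convert hA.inter hB.nullMeasurableSet using 1
  ext x
  refine and_congr_right fun hx => ?_
  exact (Set.ext_iff.1 hBeq ⟨x, hx⟩).symm

theorem DenseAtDir.exists_approxInDir {n : ℕ} {A : Set (Euc n)} {x ζ : Euc n} (hx : x ∈ A)
    (h : DenseAtDir A x ζ) : ∃ c, ApproxInDir A x ζ c := by
  have hex : ∀ t : ℝ, ∃ v : Euc n, 0 < t →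
      x + v ∈ A ∧ dist (x + t • ζ) (x + v) < infDist (x + t • ζ) A + t ^ 2 := by
    intro t
    by_cases ht : 0 < t
    · obtain ⟨a, ha, hlt⟩ := (infDist_lt_iff ⟨x, hx⟩).1
        (show infDist (x + t • ζ) A < infDist (x + t • ζ) A + t ^ 2 by
          have := pow_pos ht 2; linarith)
      exact ⟨a - x, fun _ => by simpa using ⟨ha, hlt⟩⟩
    · exact ⟨0, fun h => absurd h ht⟩
  choose c hc using hex
  refine ⟨c, fun t ht => (hc t ht).1, ?_⟩
  rw [Metric.tendsto_nhds]
  intro ε hε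
  set η : ℝ := min (1 / 2) (ε / (2 * (‖ζ‖ + 1))) with hη
  have hz : 0 < ‖ζ‖ + 1 := by positivity
  have hη0 : 0 < η := lt_min (by norm_num) (by positivity)
  have hη1 : η < 1 := (min_le_left _ _).trans_lt (by norm_num)
  have hηε : η * ‖ζ‖ ≤ ε / 2 := by
    calc η * ‖ζ‖ ≤ (ε / (2 * (‖ζ‖ + 1))) * (‖ζ‖ + 1) := by
          gcongr
          · exact min_le_right _ _
          · linarith
      _ = ε / 2 := by field_simp
  have hsmall : ∀ᶠ t : ℝ in 𝓝[>] 0, t < ε / 2 :=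
    mem_nhdsWithin_of_mem_nhds (Iio_mem_nhds (by positivity))
  have hvol := h.eventually (gt_mem_nhds (ENNReal.ofReal_pos.2 hη0))
  filter_upwards [hvol, hsmall, self_mem_nhdsWithin] with t hvt hts ht
  have ht : 0 < t := ht
  obtain ⟨θ, hθ, hθA⟩ : ∃ θ ∈ Ioo (t - η * t) t, x + θ • ζ ∈ A := by
    by_contra! hno
    have hsub : Ioo (t - η * t) t ⊆ {θ : ℝ | θ ∈ Ioo 0 t ∧ x + θ • ζ ∉ A} := fun θ hθ =>
      ⟨⟨by nlinarith [hθ.1], hθ.2⟩, hno θ hθ⟩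
    have hle := measure_mono (μ := volume) hsub
    rw [Real.volume_Ioo, sub_sub_cancel, ENNReal.ofReal_mul hη0.le] at hle
    refine hvt.not_ge ?_
    rwa [ENNReal.le_div_iff_mul_le (Or.inl (by simpa using ht)) (Or.inl ENNReal.ofReal_ne_top)]
  have hinf : infDist (x + t • ζ) A ≤ t * (ε / 2) := by
    calc infDist (x + t • ζ) A ≤ dist (x + t • ζ) (x + θ • ζ) := infDist_le_dist_of_mem hθA
      _ = (t - θ) * ‖ζ‖ := by
          rw [dist_add_left, dist_eq_norm, ← sub_smul, norm_smul, Real.norm_of_nonneg]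
          linarith [hθ.2]
      _ ≤ (η * t) * ‖ζ‖ := by gcongr; linarith [hθ.1]
      _ = t * (η * ‖ζ‖) := by ring
      _ ≤ t * (ε / 2) := by gcongr
  have hd := (hc t ht).2
  rw [dist_add_left, dist_comm, dist_eq_norm] at hd
  rw [Real.dist_eq, sub_zero, abs_of_nonneg (by positivity), div_lt_iff₀ ht]
  nlinarith

theorem HasDirDeriv.exists_forall_norm_sub_le {n : ℕ} {X : Type*} [NormedAddCommGroup X]
    [NormedSpace ℝ X] {A : Set (Euc n)} {f : Euc n → X} {x ζ : Euc n} {w : X}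
    (h : HasDirDeriv A f x ζ w) {c₀ : ℝ → Euc n} (hc₀ : ApproxInDir A x ζ c₀) {ε : ℝ}
    (hε : 0 < ε) :
    ∃ k : ℕ, ∀ a ∈ A, ∀ s ∈ Ioo 0 (1 / ((k : ℝ) + 1)),
      ‖a - x - s • ζ‖ < s * (1 / ((k : ℝ) + 1)) → ‖s⁻¹ • (f a - f x) - w‖ ≤ ε := by
  classical
  by_contra! hno
  choose a haA s hs has hbad using hno
  set c : ℝ → Euc n := fun t => if ht : ∃ k, s k = t then a ht.choose - x else c₀ t with hcdef
  have hs0 : Tendsto s atTop (𝓝[>] 0) :=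
    tendsto_nhdsWithin_iff.2 ⟨squeeze_zero (fun k => (hs k).1.le) (fun k => (hs k).2.le)
      tendsto_one_div_add_atTop_nhds_zero_nat, Eventually.of_forall fun k => (hs k).1⟩
  have hc : ApproxInDir A x ζ c := by
    refine ⟨fun t ht => ?_, ?_⟩
    · by_cases hk : ∃ k, s k = t
      · simpa [hcdef, hk] using haA _
      · simpa [hcdef, hk] using hc₀.1 t ht
    · rw [Metric.tendsto_nhds]
      intro r hr
      obtain ⟨N, hN⟩ := exists_nat_one_div_lt hr
      have hlarge : ∀ᶠ t in 𝓝[>] (0 : ℝ), ∀ k ∈ Finset.range N, t < s k :=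
        (Finset.eventually_all _).2 fun k _ =>
          mem_nhdsWithin_of_mem_nhds (Iio_mem_nhds (hs k).1)
      filter_upwards [hlarge, Metric.tendsto_nhds.1 hc₀.2 r hr, self_mem_nhdsWithin]
        with t htl ht₀ ht
      have ht : 0 < t := ht
      by_cases hk : ∃ k, s k = t
      · have hst := hk.choose_spec
        have hNk : N ≤ hk.choose := by
          by_contra! hlt
          exact (htl _ (Finset.mem_range.2 hlt)).ne' hst
        have hclose := has hk.choose
        rw [hst] at hclose
        have hmono : (1 : ℝ) / ((hk.choose : ℝ) + 1) ≤ 1 / ((N : ℝ) + 1) := by gcongr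
        simp only [hcdef, hk, dite_true]
        rw [Real.dist_eq, sub_zero, abs_of_nonneg (by positivity), div_lt_iff₀ ht]
        nlinarith
      · simpa only [hcdef, hk, dite_false] using ht₀
  have hlim := (h c hc).comp hs0
  obtain ⟨k, hk⟩ := (Metric.tendsto_nhds.1 hlim ε hε).exists
  have hex : ∃ j, s j = s k := ⟨k, rfl⟩
  have hb := hbad hex.choose
  rw [hex.choose_spec] at hb
  simp only [Function.comp_apply, hcdef, hex, dite_true, add_sub_cancel, dist_eq_norm] at hk
  exact hk.not_gt hb

theorem HasDirDeriv.quotientsOscLE {n : ℕ} {X : Type*} [NormedAddCommGroup X] [NormedSpace ℝ X]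
    {A : Set (Euc n)} {f : Euc n → X} {x ζ : Euc n} {w : X} (h : HasDirDeriv A f x ζ w)
    {c₀ : ℝ → Euc n} (hc₀ : ApproxInDir A x ζ c₀) {ε : ℝ} (hε : 0 < ε) :
    ∃ k : ℕ, QuotientsOscLE A f ζ ε (1 / ((k : ℝ) + 1)) x := by
  obtain ⟨k, hk⟩ := h.exists_forall_norm_sub_le hc₀ (half_pos hε)
  refine ⟨k, fun a ha b hb s hs t ht has hbt => ?_⟩
  have h₁ := hk a ha s hs has
  have h₂ := hk b hb t ht hbt
  rw [← dist_eq_norm] at h₁ h₂ ⊢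
  linarith [dist_triangle_right (s⁻¹ • (f a - f x)) (t⁻¹ • (f b - f x)) w]

theorem ApproxInDir.eventually_norm_sub_lt {n : ℕ} {A : Set (Euc n)} {x ζ : Euc n}
    {c : ℝ → Euc n} (hc : ApproxInDir A x ζ c) {δ : ℝ} (hδ : 0 < δ) :
    ∀ᶠ t in 𝓝[>] (0 : ℝ), t ∈ Ioo 0 δ ∧ ‖x + c t - x - t • ζ‖ < t * δ := by
  filter_upwards [hc.2.eventually (gt_mem_nhds hδ), Ioo_mem_nhdsGT hδ] with t ht htδ
  rw [div_lt_iff₀ htδ.1] at ht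
  refine ⟨htδ, ?_⟩
  rwa [add_sub_cancel_left, mul_comm]

theorem exists_hasDirDeriv_of_quotientsOscLE {n : ℕ} {X : Type*} [NormedAddCommGroup X]
    [NormedSpace ℝ X] [CompleteSpace X] {A : Set (Euc n)} {f : Euc n → X} {x ζ : Euc n}
    (h : ∀ ε > 0, ∃ δ > 0, QuotientsOscLE A f ζ ε δ x) : ∃ w, HasDirDeriv A f x ζ w := by
  by_cases hex : ∃ c₀, ApproxInDir A x ζ c₀
  · obtain ⟨c₀, hc₀⟩ := hex
    have hcauchy : Cauchy (map (fun t : ℝ => t⁻¹ • (f (x + c₀ t) - f x)) (𝓝[>] 0)) := by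
      refine Metric.cauchy_iff.2 ⟨inferInstance, fun ε hε => ?_⟩
      obtain ⟨δ, hδ, hosc⟩ := h (ε / 2) (half_pos hε)
      refine ⟨_, image_mem_map (hc₀.eventually_norm_sub_lt hδ), ?_⟩
      rintro _ ⟨s, ⟨hs, hsc⟩, rfl⟩ _ ⟨t, ⟨ht, htc⟩, rfl⟩
      rw [dist_eq_norm]
      exact (hosc _ (hc₀.1 s hs.1) _ (hc₀.1 t ht.1) s hs t ht hsc htc).trans_lt (half_lt_self hε)
    obtain ⟨w, hw⟩ := CompleteSpace.complete hcauchy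
    refine ⟨w, fun c hc => ?_⟩
    rw [Metric.tendsto_nhds]
    intro ε hε
    obtain ⟨δ, hδ, hosc⟩ := h (ε / 2) (half_pos hε)
    filter_upwards [hc.eventually_norm_sub_lt hδ, hc₀.eventually_norm_sub_lt hδ,
      Metric.tendsto_nhds.1 hw (ε / 2) (half_pos hε)] with t ht ht₀ hlim
    have hd := hosc _ (hc.1 t ht.1.1) _ (hc₀.1 t ht.1.1) t ht.1 t ht.1 ht.2 ht₀.2
    rw [← dist_eq_norm] at hd
    linarith [dist_triangle (t⁻¹ • (f (x + c t) - f x)) (t⁻¹ • (f (x + c₀ t) - f x)) w]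
  · exact ⟨0, fun c hc => absurd ⟨c, hc⟩ hex⟩

theorem DenseAtDir.exists_hasDirDeriv_iff {n : ℕ} {X : Type*} [NormedAddCommGroup X]
    [NormedSpace ℝ X] [CompleteSpace X] {A : Set (Euc n)} {f : Euc n → X} {x ζ : Euc n}
    (hx : x ∈ A) (hd : DenseAtDir A x ζ) :
    (∃ w, HasDirDeriv A f x ζ w) ↔ ∀ m : ℕ, ∃ k : ℕ,
      QuotientsOscLE A f ζ (1 / ((m : ℝ) + 1)) (1 / ((k : ℝ) + 1)) x := by
  refine ⟨fun ⟨w, hw⟩ m => ?_, fun h => exists_hasDirDeriv_of_quotientsOscLE fun ε hε => ?_⟩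
  · obtain ⟨c₀, hc₀⟩ := hd.exists_approxInDir hx
    exact hw.quotientsOscLE hc₀ Nat.one_div_pos_of_nat
  · obtain ⟨m, hm⟩ := exists_nat_one_div_lt hε
    obtain ⟨k, hk⟩ := h m
    exact ⟨_, Nat.one_div_pos_of_nat, fun a ha b hb s hs t ht has hbt =>
      (hk a ha b hb s hs t ht has hbt).trans hm.le⟩

theorem denseAtDir_iff_tendsto_rat {n : ℕ} (B : Set (Euc n)) (x ζ : Euc n) :
    DenseAtDir B x ζ ↔ Tendsto (fun q : ℚ =>
      volume {θ : ℝ | θ ∈ Ioo 0 (q : ℝ) ∧ x + θ • ζ ∉ B} / ENNReal.ofReal q)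
      (comap (fun q : ℚ => (q : ℝ)) (𝓝[>] 0)) (𝓝 0) := by
  refine ⟨fun h => h.comp tendsto_comap, fun h => ?_⟩
  rw [ENNReal.tendsto_nhds_zero] at h
  refine ENNReal.tendsto_nhds_zero.2 fun ε hε => ?_
  obtain ⟨S, hS, hSsub⟩ := mem_comap.1 (h (ε / 2) (ENNReal.half_pos hε.ne'))
  obtain ⟨δ, hδ, hδS⟩ := mem_nhdsGT_iff_exists_Ioo_subset.1 hS
  have hδ : 0 < δ := hδ
  filter_upwards [Ioo_mem_nhdsGT (half_pos hδ)] with t ht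
  obtain ⟨q, htq, hqt⟩ := exists_rat_btwn (show t < 2 * t by linarith [ht.1])
  have hq0 : 0 < (q : ℝ) := ht.1.trans htq
  have hq := hSsub (show (q : ℝ) ∈ S from hδS ⟨hq0, by linarith [ht.2]⟩)
  have hq : volume {θ : ℝ | θ ∈ Ioo 0 (q : ℝ) ∧ x + θ • ζ ∉ B} / ENNReal.ofReal q ≤ ε / 2 := hq
  rw [ENNReal.div_le_iff (by simpa using hq0) ENNReal.ofReal_ne_top] at hq
  rw [ENNReal.div_le_iff (by simpa using ht.1) ENNReal.ofReal_ne_top]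
  calc volume {θ : ℝ | θ ∈ Ioo 0 t ∧ x + θ • ζ ∉ B}
      ≤ volume {θ : ℝ | θ ∈ Ioo 0 (q : ℝ) ∧ x + θ • ζ ∉ B} :=
        measure_mono fun θ hθ => ⟨⟨hθ.1.1, hθ.1.2.trans htq⟩, hθ.2⟩
    _ ≤ ε / 2 * ENNReal.ofReal q := hq
    _ ≤ ε / 2 * ENNReal.ofReal (2 * t) := by gcongr
    _ = ε * ENNReal.ofReal t := by
        rw [ENNReal.ofReal_mul zero_le_two, ENNReal.ofReal_ofNat, ← mul_assoc,
          ENNReal.div_mul_cancel two_ne_zero ENNReal.ofNat_ne_top]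

theorem measurableSet_denseAtDir {n : ℕ} {B : Set (Euc n)} (hB : MeasurableSet B) (ζ : Euc n) :
    MeasurableSet {x | DenseAtDir B x ζ} := by
  simp only [denseAtDir_iff_tendsto_rat]
  refine measurableSet_tendsto (𝓝 0) fun q => Measurable.div_const ?_ _
  have hset : MeasurableSet {p : Euc n × ℝ | p.2 ∈ Ioo 0 (q : ℝ) ∧ p.1 + p.2 • ζ ∉ B} :=
    (measurable_snd measurableSet_Ioo).inter
      ((show Measurable fun p : Euc n × ℝ => p.1 + p.2 • ζ by fun_prop) hB.compl)
  exact measurable_measure_prodMk_left hset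

theorem ae_denseAtDir_congr {n : ℕ} {A B : Set (Euc n)} (h : A =ᵐ[volume] B) (ζ : Euc n) :
    ∀ᵐ x : Euc n, DenseAtDir A x ζ ↔ DenseAtDir B x ζ := by
  have hqmp : Measure.QuasiMeasurePreserving (fun p : Euc n × ℝ => p.1 + p.2 • ζ)
      (volume.prod volume) volume :=
    QuasiMeasurePreserving.prod_of_left (by fun_prop) (Eventually.of_forall fun θ =>
      (measurePreserving_add_right volume (θ • ζ)).quasiMeasurePreserving)
  filter_upwards [Measure.ae_ae_of_ae_prod (hqmp.ae h.mem_iff)] with x hx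
  refine iff_of_eq (congrArg (Tendsto · _ _) (funext fun t => ?_))
  congr 1
  refine measure_congr ?_
  filter_upwards [hx] with θ hθ
  exact propext (and_congr_right fun _ => not_congr hθ)

theorem nullMeasurableSet_denseAtDir {n : ℕ} {A : Set (Euc n)} (hA : NullMeasurableSet A volume)
    (ζ : Euc n) : NullMeasurableSet {x | DenseAtDir A x ζ} volume := by
  obtain ⟨B, hB, hAB⟩ := hA
  refine ⟨_, measurableSet_denseAtDir hB ζ, ?_⟩
  filter_upwards [ae_denseAtDir_congr hAB ζ] with x hx using propext hx

/-- For a Lipschitz map into a separable Banach space, the set of points of the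
domain at which the domain is directionally dense and the map is directionally
differentiable in a fixed nonzero direction is Lebesgue measurable. -/
theorem stmt15 {n : ℕ} {X : Type*} [NormedAddCommGroup X] [NormedSpace ℝ X]
    [CompleteSpace X] [TopologicalSpace.SeparableSpace X]
    (A : Set (Euc n)) (hA : NullMeasurableSet A volume)
    (f : Euc n → X) (K : NNReal) (hf : LipschitzOnWith K f A)
    (ζ : Euc n) (hζ : ζ ≠ 0) :
    NullMeasurableSet
      {x : Euc n | x ∈ A ∧ DenseAtDir A x ζ ∧ ∃ w : X, HasDirDeriv A f x ζ w}
      (volume : Measure (Euc n)) := by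
  convert (nullMeasurableSet_denseAtDir hA ζ).inter
    (nullMeasurableSet_quotientsOscLE hA hf.continuousOn ζ) using 1
  ext x
  simp only [mem_ofPred_eq, mem_inter_iff]
  constructor
  · rintro ⟨hx, hd, hw⟩
    exact ⟨hd, hx, (hd.exists_hasDirDeriv_iff hx).1 hw⟩
  · rintro ⟨hd, hx, hq⟩
    exact ⟨hx, hd, (hd.exists_hasDirDeriv_iff hx).2 hq⟩
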